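/- arXiv:2003.07534 — 5 statements merged into one kernel-verified Lean document; each statement's English description precedes it below -/
import Mathlib

section
/- Let m ≥ 3 and let A, B ∈ F_2^m satisfy supp(B) ⊊ supp(A) and |B| ≥ 1. Let D = Δ_A \ Δ_B. Then the binary linear code C_D has length 2^{|A|} − 2^{|B|}, dimension |A| over F_2, and minimum distance 2^{|A|−1} − 2^{|B|−1}; moreover C_D is a two-weight code having exactly 2^{|A|} − 2^{|A|−|B|} codewords of weight 2^{|A|−1} − 2^{|B|−1}, exactly 2^{|A|−|B|} − 1 codewords of weight 2^{|A|−1}, and no other nonzero weights. -/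
open Finset

def supp {m : ℕ} (v : Fin m → ZMod 2) : Finset (Fin m) :=
  Finset.univ.filter fun i => v i ≠ 0

def wt {m : ℕ} (v : Fin m → ZMod 2) : ℕ := (supp v).card

def delta {m : ℕ} (A : Fin m → ZMod 2) : Finset (Fin m → ZMod 2) :=
  Finset.univ.filter fun v => supp v ⊆ supp A

def deltaT {m : ℕ} (T : Finset (Fin m)) : Finset (Fin m → ZMod 2) :=
  Finset.univ.filter fun v => supp v ⊆ T

def hwt {ι : Type*} [Fintype ι] (c : ι → ZMod 2) : ℕ :=
  (Finset.univ.filter fun i => c i ≠ 0).card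

def cw {m : ℕ} (D : Finset (Fin m → ZMod 2)) (u : Fin m → ZMod 2) : ↥D → ZMod 2 :=
  fun g => ∑ i, u i * (g : Fin m → ZMod 2) i

def codeC {m : ℕ} (D : Finset (Fin m → ZMod 2)) :
    Submodule (ZMod 2) (↥D → ZMod 2) :=
  LinearMap.range (Matrix.mulVecLin (Matrix.of fun (g : ↥D) (i : Fin m) => (g : Fin m → ZMod 2) i))

def dualCode {ι : Type*} [Fintype ι] (C : Submodule (ZMod 2) (ι → ZMod 2)) :
    Submodule (ZMod 2) (ι → ZMod 2) where
  carrier := {w | ∀ c ∈ C, ∑ i, w i * c i = 0}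
  zero_mem' := by simp
  add_mem' := by
    intro a b ha hb c hc
    have h := congrArg₂ (· + ·) (ha c hc) (hb c hc)
    simpa [add_mul, Finset.sum_add_distrib] using h
  smul_mem' := by
    intro r w hw c hc
    have h := congrArg (r * ·) (hw c hc)
    simpa [Finset.mul_sum, mul_assoc] using h

def isMinDist {ι : Type*} [Fintype ι] (C : Set (ι → ZMod 2)) (d : ℕ) : Prop :=
  (∃ c ∈ C, c ≠ 0 ∧ hwt c = d) ∧ ∀ c ∈ C, c ≠ 0 → d ≤ hwt c

def chi {m : ℕ} (u v : Fin m → ZMod 2) : ℤ :=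
  if supp u ∩ supp v = ∅ then 1 else 0

theorem mem_supp {m : ℕ} {v : Fin m → ZMod 2} {i : Fin m} : i ∈ supp v ↔ v i ≠ 0 := by
  simp [supp]

theorem mem_deltaT {m : ℕ} {T : Finset (Fin m)} {v : Fin m → ZMod 2} :
    v ∈ deltaT T ↔ ∀ i, v i ≠ 0 → i ∈ T := by
  simp only [deltaT, Finset.mem_filter, Finset.mem_univ, true_and, Finset.subset_iff, mem_supp]

theorem card_deltaT {m : ℕ} (T : Finset (Fin m)) : (deltaT T).card = 2 ^ T.card := by
  rw [← Finset.card_powerset]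
  refine Finset.card_bij' (fun v _ => supp v) (fun S _ i => if i ∈ S then 1 else 0) ?_ ?_ ?_ ?_
  · intro v hv
    simpa [deltaT] using hv
  · intro S hS
    rw [Finset.mem_powerset] at hS
    refine mem_deltaT.mpr fun i hi => hS ?_
    by_contra h
    simp [h] at hi
  · intro v _
    funext i
    have h : ∀ x : ZMod 2, (if x ≠ 0 then (1 : ZMod 2) else 0) = x := by decide
    simpa [supp] using h (v i)
  · intro S _
    ext i
    simp [supp]

theorem sum_mul_eq_zero_of_disjoint {m : ℕ} {u v : Fin m → ZMod 2} {T : Finset (Fin m)}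
    (h : Disjoint (supp u) T) (hv : v ∈ deltaT T) : ∑ i, u i * v i = 0 := by
  refine Finset.sum_eq_zero fun i _ => ?_
  by_contra hne
  have hu : i ∈ supp u := by
    simpa [supp] using left_ne_zero_of_mul hne
  have hvT : i ∈ T := by
    have hsub : supp v ⊆ T := by simpa [deltaT] using hv
    exact hsub (by simpa [supp] using right_ne_zero_of_mul hne)
  exact Finset.disjoint_left.mp h hu hvT

theorem add_single_mem_deltaT {m : ℕ} {T : Finset (Fin m)} {i : Fin m} (hi : i ∈ T)
    {v : Fin m → ZMod 2} (hv : v ∈ deltaT T) : v + Pi.single i 1 ∈ deltaT T := by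
  rw [mem_deltaT] at hv ⊢
  intro j hj
  by_cases hji : j = i
  · exact hji ▸ hi
  · exact hv j (by simpa [hji] using hj)

theorem sum_mul_add_single {m : ℕ} {u : Fin m → ZMod 2} {i : Fin m} (hi : i ∈ supp u)
    (v : Fin m → ZMod 2) :
    ∑ j, u j * (v + Pi.single i 1 : Fin m → ZMod 2) j = ∑ j, u j * v j + 1 := by
  have hu : u i = 1 := by
    have h : ∀ x : ZMod 2, x ≠ 0 → x = 1 := by decide
    exact h _ (by simpa [supp] using hi)
  simp [mul_add, Finset.sum_add_distrib, Pi.single_apply, hu]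

theorem card_deltaT_filter_ne_zero {m : ℕ} {u : Fin m → ZMod 2} {T : Finset (Fin m)}
    (h : ¬ Disjoint (supp u) T) :
    ((deltaT T).filter fun v => ∑ i, u i * v i ≠ 0).card = 2 ^ (T.card - 1) := by
  obtain ⟨i, hiu, hiT⟩ := Finset.not_disjoint_iff.mp h
  have hadd : ∀ v : Fin m → ZMod 2, v + Pi.single i 1 + Pi.single i 1 = v := fun v => by
    funext j
    simp [add_assoc, CharTwo.add_self_eq_zero]
  have hflip : ∀ x : ZMod 2, x + 1 ≠ 0 ↔ ¬ x ≠ 0 := by decide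
  have hbij : ((deltaT T).filter fun v => ∑ i, u i * v i ≠ 0).card =
      ((deltaT T).filter fun v => ¬ ∑ i, u i * v i ≠ 0).card := by
    refine Finset.card_bij' (fun v _ => v + Pi.single i 1) (fun v _ => v + Pi.single i 1)
      ?_ ?_ (fun v _ => hadd v) (fun v _ => hadd v)
    · intro v hv
      rw [Finset.mem_filter] at hv ⊢
      refine ⟨add_single_mem_deltaT hiT hv.1, ?_⟩
      rw [sum_mul_add_single hiu, hflip]
      exact not_not.mpr hv.2
    · intro v hv
      rw [Finset.mem_filter] at hv ⊢
      refine ⟨add_single_mem_deltaT hiT hv.1, ?_⟩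
      rw [sum_mul_add_single hiu, hflip]
      exact hv.2
  have hsum := Finset.card_filter_add_card_filter_not (s := deltaT T)
    (fun v => ∑ i, u i * v i ≠ 0)
  rw [← hbij, card_deltaT] at hsum
  have hT : T.card = T.card - 1 + 1 := (Nat.sub_add_cancel (Finset.card_pos.mpr ⟨i, hiT⟩)).symm
  rw [hT, pow_succ] at hsum
  omega

theorem deltaT_mono {m : ℕ} {S T : Finset (Fin m)} (h : S ⊆ T) : deltaT S ⊆ deltaT T := by
  intro v hv
  simp only [deltaT, Finset.mem_filter, Finset.mem_univ, true_and] at hv ⊢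
  exact hv.trans h

theorem hwt_cw {m : ℕ} (D : Finset (Fin m → ZMod 2)) (u : Fin m → ZMod 2) :
    hwt (cw D u) = (D.filter fun v => ∑ i, u i * v i ≠ 0).card := by
  rw [hwt, ← Finset.card_map (Function.Embedding.subtype _)]
  congr 1
  ext v
  simp only [Finset.mem_map, Finset.mem_filter, Finset.mem_univ, true_and]
  constructor
  · rintro ⟨g, hg, rfl⟩
    exact ⟨g.2, hg⟩
  · rintro ⟨hv, hne⟩
    exact ⟨⟨v, hv⟩, hne, rfl⟩

theorem hwt_cw_sdiff {m : ℕ} {S T : Finset (Fin m)} (h : S ⊆ T) (u : Fin m → ZMod 2) :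
    hwt (cw (deltaT T \ deltaT S) u) =
      ((deltaT T).filter fun v => ∑ i, u i * v i ≠ 0).card -
        ((deltaT S).filter fun v => ∑ i, u i * v i ≠ 0).card := by
  rw [hwt_cw, ← Finset.card_sdiff_of_subset (Finset.filter_subset_filter _ (deltaT_mono h))]
  congr 1
  ext v
  simp only [Finset.mem_filter, Finset.mem_sdiff]
  tauto

theorem card_deltaT_filter_of_disjoint {m : ℕ} {u : Fin m → ZMod 2} {T : Finset (Fin m)}
    (h : Disjoint (supp u) T) :
    ((deltaT T).filter fun v => ∑ i, u i * v i ≠ 0).card = 0 := by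
  rw [Finset.card_eq_zero, Finset.filter_eq_empty_iff]
  exact fun v hv => not_not.mpr (sum_mul_eq_zero_of_disjoint h hv)

theorem hwt_cw_of_disjoint {m : ℕ} {S T : Finset (Fin m)} (h : S ⊆ T) {u : Fin m → ZMod 2}
    (hT : ¬ Disjoint (supp u) T) (hS : Disjoint (supp u) S) :
    hwt (cw (deltaT T \ deltaT S) u) = 2 ^ (T.card - 1) := by
  rw [hwt_cw_sdiff h, card_deltaT_filter_ne_zero hT, card_deltaT_filter_of_disjoint hS, Nat.sub_zero]

theorem hwt_cw_of_not_disjoint {m : ℕ} {S T : Finset (Fin m)} (h : S ⊆ T) {u : Fin m → ZMod 2}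
    (hS : ¬ Disjoint (supp u) S) :
    hwt (cw (deltaT T \ deltaT S) u) = 2 ^ (T.card - 1) - 2 ^ (S.card - 1) := by
  rw [hwt_cw_sdiff h, card_deltaT_filter_ne_zero hS,
    card_deltaT_filter_ne_zero fun hT => hS (hT.mono_right h)]

theorem hwt_zero {ι : Type*} [Fintype ι] : hwt (0 : ι → ZMod 2) = 0 := by
  simp [hwt]

theorem cw_sub {m : ℕ} (D : Finset (Fin m → ZMod 2)) (u v : Fin m → ZMod 2) :
    cw D (u - v) = cw D u - cw D v := by
  funext g
  simp [cw, sub_mul]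

theorem cw_zero {m : ℕ} (D : Finset (Fin m → ZMod 2)) : cw D 0 = 0 := by
  funext g
  simp [cw]

theorem mem_codeC_iff {m : ℕ} {D : Finset (Fin m → ZMod 2)} {c : ↥D → ZMod 2} :
    c ∈ codeC D ↔ ∃ u, cw D u = c := by
  have h : ∀ u, Matrix.mulVecLin (Matrix.of fun (g : ↥D) (i : Fin m) =>
      (g : Fin m → ZMod 2) i) u = cw D u := by
    intro u
    funext g
    simp [cw, Matrix.mulVec, dotProduct, mul_comm]
  simp only [codeC, LinearMap.mem_range, h]

theorem coe_codeC_eq_image {m : ℕ} {T : Finset (Fin m)} {D : Finset (Fin m → ZMod 2)}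
    (hD : D ⊆ deltaT T) :
    (codeC D : Set (↥D → ZMod 2)) = cw D '' (deltaT T : Set (Fin m → ZMod 2)) := by
  ext c
  rw [SetLike.mem_coe, mem_codeC_iff]
  constructor
  · rintro ⟨u, rfl⟩
    refine ⟨fun i => if i ∈ T then u i else 0, ?_, ?_⟩
    · refine Finset.mem_coe.mpr (mem_deltaT.mpr fun i hi => ?_)
      by_contra h
      simp [h] at hi
    · funext g
      refine Finset.sum_congr rfl fun i _ => ?_
      by_cases hi : i ∈ T
      · simp [hi]
      · have hg : supp (g : Fin m → ZMod 2) ⊆ T := by simpa [deltaT] using hD g.2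
        have h0 : (g : Fin m → ZMod 2) i = 0 := by
          by_contra h
          exact hi (hg (by simpa [supp] using h))
        simp [h0]
  · rintro ⟨u, _, rfl⟩
    exact ⟨u, rfl⟩

theorem eq_zero_of_mem_deltaT_of_disjoint {m : ℕ} {T : Finset (Fin m)} {u : Fin m → ZMod 2}
    (hu : u ∈ deltaT T) (h : Disjoint (supp u) T) : u = 0 := by
  have hsub : supp u ⊆ T := by simpa [deltaT] using hu
  have h0 : supp u = ∅ := by simpa using h.mono_right hsub
  funext i
  by_contra hi
  have : i ∈ supp u := by simpa [supp] using hi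
  simp [h0] at this

theorem sub_mem_deltaT {m : ℕ} {T : Finset (Fin m)} {u v : Fin m → ZMod 2}
    (hu : u ∈ deltaT T) (hv : v ∈ deltaT T) : u - v ∈ deltaT T := by
  rw [mem_deltaT] at hu hv ⊢
  intro i hi
  by_contra h
  have hui : u i = 0 := by
    by_contra h'
    exact h (hu i h')
  have hvi : v i = 0 := by
    by_contra h'
    exact h (hv i h')
  simp [hui, hvi] at hi

theorem two_pow_lt_two_pow_pred {m : ℕ} {S T : Finset (Fin m)} (h : S ⊂ T) (hS : S.Nonempty) :
    2 ^ (S.card - 1) < 2 ^ (T.card - 1) := by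
  have h1 := Finset.card_lt_card h
  have h2 := hS.card_pos
  exact Nat.pow_lt_pow_right (by norm_num) (by omega)

theorem hwt_cw_pos {m : ℕ} {S T : Finset (Fin m)} (h : S ⊂ T) (hS : S.Nonempty)
    {u : Fin m → ZMod 2} (hT : ¬ Disjoint (supp u) T) :
    0 < hwt (cw (deltaT T \ deltaT S) u) := by
  by_cases hu : Disjoint (supp u) S
  · rw [hwt_cw_of_disjoint h.subset hT hu]
    positivity
  · rw [hwt_cw_of_not_disjoint h.subset hu]
    exact Nat.sub_pos_of_lt (two_pow_lt_two_pow_pred h hS)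

theorem cw_injOn {m : ℕ} {S T : Finset (Fin m)} (h : S ⊂ T) (hS : S.Nonempty) :
    Set.InjOn (cw (deltaT T \ deltaT S)) (deltaT T : Set (Fin m → ZMod 2)) := by
  intro u hu v hv huv
  rw [← sub_eq_zero]
  refine eq_zero_of_mem_deltaT_of_disjoint (sub_mem_deltaT hu hv) ?_
  by_contra hT
  have hpos := hwt_cw_pos h hS hT
  rw [cw_sub, huv, sub_self, hwt_zero] at hpos
  exact lt_irrefl _ hpos

theorem ncard_codeC_hwt_eq {m : ℕ} {S T : Finset (Fin m)} (h : S ⊂ T) (hS : S.Nonempty) (w : ℕ) :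
    {c | c ∈ codeC (deltaT T \ deltaT S) ∧ hwt c = w}.ncard =
      ((deltaT T).filter fun u => hwt (cw (deltaT T \ deltaT S) u) = w).card := by
  have himage : {c | c ∈ codeC (deltaT T \ deltaT S) ∧ hwt c = w} =
      cw (deltaT T \ deltaT S) ''
        ((deltaT T).filter fun u => hwt (cw (deltaT T \ deltaT S) u) = w : Finset _) := by
    ext c
    rw [Set.mem_ofPred_eq, ← SetLike.mem_coe, coe_codeC_eq_image Finset.sdiff_subset]
    constructor
    · rintro ⟨⟨u, hu, rfl⟩, hw⟩
      exact ⟨u, by simpa using ⟨hu, hw⟩, rfl⟩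
    · rintro ⟨u, hu, rfl⟩
      rw [Finset.mem_coe, Finset.mem_filter] at hu
      exact ⟨⟨u, hu.1, rfl⟩, hu.2⟩
  rw [himage, Set.InjOn.ncard_image, Set.ncard_coe_finset]
  exact (cw_injOn h hS).mono (Finset.coe_subset.mpr (Finset.filter_subset _ _))

theorem finrank_codeC {m : ℕ} {S T : Finset (Fin m)} (h : S ⊂ T) (hS : S.Nonempty) :
    Module.finrank (ZMod 2) (codeC (deltaT T \ deltaT S)) = T.card := by
  have hcard : Nat.card (codeC (deltaT T \ deltaT S)) = 2 ^ T.card := by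
    rw [← card_deltaT, ← Set.ncard_coe_finset, ← (cw_injOn h hS).ncard_image,
      ← coe_codeC_eq_image Finset.sdiff_subset]
    rfl
  rw [Module.natCard_eq_pow_finrank (K := ZMod 2), Nat.card_zmod] at hcard
  exact Nat.pow_right_injective le_rfl hcard

theorem mem_deltaT_sdiff_iff {m : ℕ} {S T : Finset (Fin m)} {u : Fin m → ZMod 2} :
    u ∈ deltaT (T \ S) ↔ u ∈ deltaT T ∧ Disjoint (supp u) S := by
  simp only [deltaT, Finset.mem_filter, Finset.mem_univ, true_and]
  exact Finset.subset_sdiff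

theorem zero_mem_deltaT {m : ℕ} (T : Finset (Fin m)) : 0 ∈ deltaT T := by
  simp [deltaT, supp]

theorem filter_hwt_cw_eq_low {m : ℕ} {S T : Finset (Fin m)} (h : S ⊂ T) (hS : S.Nonempty) :
    ((deltaT T).filter fun u => hwt (cw (deltaT T \ deltaT S) u) =
      2 ^ (T.card - 1) - 2 ^ (S.card - 1)) = deltaT T \ deltaT (T \ S) := by
  have hlt := two_pow_lt_two_pow_pred h hS
  have hpos : 0 < 2 ^ (S.card - 1) := by positivity
  ext u
  rw [Finset.mem_filter, Finset.mem_sdiff, mem_deltaT_sdiff_iff]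
  refine and_congr_right fun hu => ⟨fun hw hd => ?_, fun hd => ?_⟩
  · by_cases hT : Disjoint (supp u) T
    · rw [eq_zero_of_mem_deltaT_of_disjoint hu hT, cw_zero, hwt_zero] at hw
      omega
    · rw [hwt_cw_of_disjoint h.subset hT hd.2] at hw
      omega
  · exact hwt_cw_of_not_disjoint h.subset fun hd' => hd ⟨hu, hd'⟩

theorem filter_hwt_cw_eq_high {m : ℕ} {S T : Finset (Fin m)} (h : S ⊂ T) (hS : S.Nonempty) :
    ((deltaT T).filter fun u => hwt (cw (deltaT T \ deltaT S) u) = 2 ^ (T.card - 1)) =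
      (deltaT (T \ S)).erase 0 := by
  have hlt := two_pow_lt_two_pow_pred h hS
  have hpos : 0 < 2 ^ (S.card - 1) := by positivity
  ext u
  rw [Finset.mem_filter, Finset.mem_erase, mem_deltaT_sdiff_iff]
  constructor
  · rintro ⟨hu, hw⟩
    refine ⟨?_, hu, ?_⟩
    · rintro rfl
      rw [cw_zero, hwt_zero] at hw
      omega
    · by_contra hd
      rw [hwt_cw_of_not_disjoint h.subset hd] at hw
      omega
  · rintro ⟨hne, hu, hd⟩
    exact ⟨hu, hwt_cw_of_disjoint h.subset
      (fun hT => hne (eq_zero_of_mem_deltaT_of_disjoint hu hT)) hd⟩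

theorem hwt_eq_of_mem_codeC {m : ℕ} {S T : Finset (Fin m)} (h : S ⊆ T)
    {c : ↥(deltaT T \ deltaT S) → ZMod 2} (hc : c ∈ codeC (deltaT T \ deltaT S)) (hne : c ≠ 0) :
    hwt c = 2 ^ (T.card - 1) - 2 ^ (S.card - 1) ∨ hwt c = 2 ^ (T.card - 1) := by
  rw [← SetLike.mem_coe, coe_codeC_eq_image Finset.sdiff_subset] at hc
  obtain ⟨u, hu, rfl⟩ := hc
  by_cases hS : Disjoint (supp u) S
  · refine Or.inr (hwt_cw_of_disjoint h (fun hT => hne ?_) hS)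
    rw [eq_zero_of_mem_deltaT_of_disjoint hu hT, cw_zero]
  · exact Or.inl (hwt_cw_of_not_disjoint h hS)

theorem isMinDist_codeC {m : ℕ} {S T : Finset (Fin m)} (h : S ⊂ T) (hS : S.Nonempty) :
    isMinDist (codeC (deltaT T \ deltaT S) : Set (↥(deltaT T \ deltaT S) → ZMod 2))
      (2 ^ (T.card - 1) - 2 ^ (S.card - 1)) := by
  have hlt := two_pow_lt_two_pow_pred h hS
  constructor
  · obtain ⟨i, hi⟩ := hS
    have hd : ¬ Disjoint (supp (Pi.single i 1 : Fin m → ZMod 2)) S :=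
      Finset.not_disjoint_iff.mpr ⟨i, by simp [supp], hi⟩
    have hw := hwt_cw_of_not_disjoint h.subset hd
    refine ⟨_, mem_codeC_iff.mpr ⟨_, rfl⟩, fun h0 => ?_, hw⟩
    rw [h0, hwt_zero] at hw
    omega
  · intro c hc hne
    rcases hwt_eq_of_mem_codeC h.subset hc hne with hw | hw
    · exact hw.ge
    · exact (Nat.sub_le _ _).trans hw.ge

theorem stmt1 {m : ℕ} (hm : 3 ≤ m) (A B : Fin m → ZMod 2)
    (hBA : supp B ⊂ supp A) (hB : 1 ≤ wt B)
    (D : Finset (Fin m → ZMod 2)) (hD : D = delta A \ delta B) :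
    D.card = 2 ^ wt A - 2 ^ wt B ∧
    Module.finrank (ZMod 2) (codeC D) = wt A ∧
    isMinDist (codeC D : Set (↥D → ZMod 2)) (2 ^ (wt A - 1) - 2 ^ (wt B - 1)) ∧
    {c : ↥D → ZMod 2 | c ∈ codeC D ∧ hwt c = 2 ^ (wt A - 1) - 2 ^ (wt B - 1)}.ncard
      = 2 ^ wt A - 2 ^ (wt A - wt B) ∧
    {c : ↥D → ZMod 2 | c ∈ codeC D ∧ hwt c = 2 ^ (wt A - 1)}.ncard
      = 2 ^ (wt A - wt B) - 1 ∧
    ∀ c ∈ codeC D, c ≠ 0 →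
      hwt c = 2 ^ (wt A - 1) - 2 ^ (wt B - 1) ∨ hwt c = 2 ^ (wt A - 1) := by
  subst hD
  have hS : (supp B).Nonempty := Finset.card_pos.mp hB
  refine ⟨?_, finrank_codeC hBA hS, isMinDist_codeC hBA hS, ?_, ?_,
    fun c hc hne => hwt_eq_of_mem_codeC hBA.subset hc hne⟩
  · exact (Finset.card_sdiff_of_subset (deltaT_mono hBA.subset)).trans
      (congrArg₂ (· - ·) (card_deltaT _) (card_deltaT _))
  · refine (ncard_codeC_hwt_eq hBA hS _).trans ((congrArg _ (filter_hwt_cw_eq_low hBA hS)).trans ?_)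
    rw [Finset.card_sdiff_of_subset (deltaT_mono Finset.sdiff_subset), card_deltaT, card_deltaT,
      Finset.card_sdiff_of_subset hBA.subset]
    rfl
  · refine (ncard_codeC_hwt_eq hBA hS _).trans ((congrArg _ (filter_hwt_cw_eq_high hBA hS)).trans ?_)
    rw [Finset.card_erase_of_mem (zero_mem_deltaT _), card_deltaT,
      Finset.card_sdiff_of_subset hBA.subset]
    rfl
end

section
/- Let m ≥ 3 and let A, B ∈ F_2^m satisfy supp(B) ⊊ supp(A). Let D = Δ_A \ Δ_B. Then the dual code C_D^⊥ has length 2^{|A|} − 2^{|B|} and dimension 2^{|A|} − 2^{|B|} − |A| over F_2, and its minimum distance δ satisfies: δ = 3 if |A| > |B| + 1, and δ = 4 if |A| = |B| + 1 and |A| ≥ 3. -/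
open Finset

lemma mem_delta {m : ℕ} {A v : Fin m → ZMod 2} :
    v ∈ delta A ↔ ∀ i, v i ≠ 0 → A i ≠ 0 := by
  simp [delta, supp, Finset.subset_iff]

lemma single_mem_delta {m : ℕ} {A : Fin m → ZMod 2} {k : Fin m} (hk : A k ≠ 0) :
    Pi.single k 1 ∈ delta A := by
  rw [mem_delta]
  intro i hi
  by_cases h : i = k
  · rwa [h]
  · simp [h] at hi

lemma add_mem_delta {m : ℕ} {A v w : Fin m → ZMod 2} (hv : v ∈ delta A) (hw : w ∈ delta A) :
    v + w ∈ delta A := by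
  rw [mem_delta] at *
  intro i hi hA
  have hvi : v i = 0 := by_contra fun h => hv i h hA
  have hwi : w i = 0 := by_contra fun h => hw i h hA
  simp [hvi, hwi] at hi

lemma mem_delta_sdiff_delta {m : ℕ} {A B v : Fin m → ZMod 2} {k : Fin m} (hv : v ∈ delta A)
    (hB : B k = 0) (hk : v k ≠ 0) : v ∈ delta A \ delta B :=
  Finset.mem_sdiff.mpr ⟨hv, fun h => mem_delta.mp h k hk hB⟩

lemma card_delta {m : ℕ} (A : Fin m → ZMod 2) : (delta A).card = 2 ^ wt A := by
  rw [wt, ← Finset.card_powerset]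
  refine Finset.card_bij (fun v _ => supp v) (fun v hv => ?_) (fun v _ w _ h => ?_)
    fun S hS => ⟨fun i => if i ∈ S then 1 else 0, ?_, ?_⟩
  · simpa [delta] using hv
  · funext i
    have hi : v i ≠ 0 ↔ w i ≠ 0 := by simpa [supp] using Finset.ext_iff.mp h i
    have key : ∀ a b : ZMod 2, (a ≠ 0 ↔ b ≠ 0) → a = b := by decide
    exact key _ _ hi
  · rw [mem_delta]
    intro i hi
    have : i ∈ S := by simpa using hi
    simpa [supp] using Finset.mem_powerset.mp hS this
  · ext i
    simp [supp]

lemma mem_dualCode_codeC {m : ℕ} {D : Finset (Fin m → ZMod 2)} {w : ↥D → ZMod 2} :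
    w ∈ dualCode (codeC D) ↔ ∑ g : ↥D, w g • (g : Fin m → ZMod 2) = 0 := by
  have swap (u : Fin m → ZMod 2) :
      ∑ g : ↥D, w g * ∑ i, (g : Fin m → ZMod 2) i * u i =
        ∑ i, (∑ g : ↥D, w g • (g : Fin m → ZMod 2)) i * u i := by
    simp only [Finset.mul_sum, Finset.sum_apply, Finset.sum_mul, Pi.smul_apply, smul_eq_mul]
    rw [Finset.sum_comm]
    simp only [mul_assoc]
  constructor
  · intro h
    funext i
    have := h _ (LinearMap.mem_range_self _ (Pi.single i 1))
    simp only [Matrix.mulVecLin_apply, Matrix.mulVec, dotProduct, Matrix.of_apply] at this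
    rw [swap] at this
    simpa [Pi.single_apply] using this
  · rintro h _ ⟨u, rfl⟩
    simp only [Matrix.mulVecLin_apply, Matrix.mulVec, dotProduct, Matrix.of_apply]
    rw [swap, h]
    simp

lemma finrank_dualCode_codeC {m : ℕ} (D : Finset (Fin m → ZMod 2)) :
    Module.finrank (ZMod 2) (dualCode (codeC D)) =
      D.card - Module.finrank (ZMod 2) (Submodule.span (ZMod 2) (D : Set (Fin m → ZMod 2))) := by
  have hker : dualCode (codeC D) =
      LinearMap.ker (Fintype.linearCombination (ZMod 2) (Subtype.val : ↥D → Fin m → ZMod 2)) := by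
    ext w
    rw [mem_dualCode_codeC, LinearMap.mem_ker, Fintype.linearCombination_apply]
  have hrange : LinearMap.range
      (Fintype.linearCombination (ZMod 2) (Subtype.val : ↥D → Fin m → ZMod 2)) =
      Submodule.span (ZMod 2) (D : Set (Fin m → ZMod 2)) := by
    rw [Fintype.range_linearCombination]
    exact congrArg _ Subtype.range_coe
  have h := LinearMap.finrank_range_add_finrank_ker
    (Fintype.linearCombination (ZMod 2) (Subtype.val : ↥D → Fin m → ZMod 2))
  rw [hrange, Module.finrank_fintype_fun_eq_card, Fintype.card_coe, ← hker] at h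
  omega

lemma coe_span_delta_sdiff_delta {m : ℕ} {A B : Fin m → ZMod 2} (hBA : supp B ⊂ supp A) :
    (Submodule.span (ZMod 2) (↑(delta A \ delta B) : Set (Fin m → ZMod 2)) :
      Set (Fin m → ZMod 2)) = ↑(delta A) := by
  obtain ⟨j, hjA, hjB⟩ := Finset.exists_of_ssubset hBA
  have hjA : A j ≠ 0 := by simpa [supp] using hjA
  have hjB : B j = 0 := by simpa [supp] using hjB
  apply Set.Subset.antisymm
  · intro v hv
    induction hv using Submodule.span_induction with
    | mem x hx => exact Finset.mem_coe.mpr (Finset.mem_sdiff.mp (Finset.mem_coe.mp hx)).1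
    | zero => simp [mem_delta]
    | add x y _ _ hx hy => exact Finset.mem_coe.mpr (add_mem_delta hx hy)
    | smul a x _ hx =>
      rw [Finset.mem_coe, mem_delta] at *
      exact fun i hi => hx i (right_ne_zero_of_mul hi)
  · intro v hv
    rw [Finset.mem_coe] at hv
    have mem_span {w : Fin m → ZMod 2} (hw : w ∈ delta A) (hj : w j ≠ 0) :=
      Submodule.subset_span (R := ZMod 2)
        (Finset.mem_coe.mpr (mem_delta_sdiff_delta hw hjB hj))
    have he := single_mem_delta hjA
    by_cases hj : v j = 0
    · simpa using Submodule.sub_mem _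
        (mem_span (add_mem_delta hv he) (by simp [hj])) (mem_span he (by simp))
    · exact mem_span hv hj

lemma finrank_span_delta_sdiff_delta {m : ℕ} {A B : Fin m → ZMod 2} (hBA : supp B ⊂ supp A) :
    Module.finrank (ZMod 2)
      (Submodule.span (ZMod 2) (↑(delta A \ delta B) : Set (Fin m → ZMod 2))) = wt A := by
  have h := Module.natCard_eq_pow_finrank (K := ZMod 2)
    (V := Submodule.span (ZMod 2) (↑(delta A \ delta B) : Set (Fin m → ZMod 2)))
  have hcard := congrArg Set.ncard (coe_span_delta_sdiff_delta hBA)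
  rw [Set.ncard_coe_finset, card_delta] at hcard
  rw [Nat.card_zmod] at h
  exact Nat.pow_right_injective le_rfl (h.symm.trans hcard)

lemma exists_mem_dualCode_of_sum_eq_zero {m : ℕ} {D S : Finset (Fin m → ZMod 2)}
    (hSD : S ⊆ D) (hS : S.Nonempty) (h : ∑ x ∈ S, x = 0) :
    ∃ c ∈ (dualCode (codeC D) : Set (↥D → ZMod 2)), c ≠ 0 ∧ hwt c = S.card := by
  refine ⟨fun g => if (g : Fin m → ZMod 2) ∈ S then 1 else 0, ?_, ?_, ?_⟩
  · rw [SetLike.mem_coe, mem_dualCode_codeC,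
      Finset.sum_coe_sort D fun g => (if g ∈ S then (1 : ZMod 2) else 0) • g]
    simpa [ite_smul, ← Finset.sum_filter, Finset.filter_mem_eq_inter,
      Finset.inter_eq_right.mpr hSD] using h
  · obtain ⟨x, hx⟩ := hS
    intro h0
    simpa [hx] using congrFun h0 ⟨x, hSD hx⟩
  · rw [hwt, ← Finset.card_map (Function.Embedding.subtype _)]
    congr 1
    ext x
    simpa using fun hx => hSD hx

lemma exists_sum_eq_zero_of_mem_dualCode {m : ℕ} {D : Finset (Fin m → ZMod 2)}
    {c : ↥D → ZMod 2} (hc : c ∈ (dualCode (codeC D) : Set (↥D → ZMod 2))) (hc0 : c ≠ 0) :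
    ∃ S ⊆ D, S.Nonempty ∧ ∑ x ∈ S, x = 0 ∧ S.card = hwt c := by
  refine ⟨(Finset.univ.filter fun g => c g ≠ 0).map (Function.Embedding.subtype _), ?_, ?_, ?_,
    Finset.card_map _⟩
  · intro x hx
    obtain ⟨g, -, rfl⟩ := Finset.mem_map.mp hx
    exact g.2
  · obtain ⟨g, hg⟩ := Function.ne_iff.mp hc0
    exact ⟨g, Finset.mem_map_of_mem _ (by simpa using hg)⟩
  · rw [SetLike.mem_coe, mem_dualCode_codeC] at hc
    rw [Finset.sum_map, Finset.sum_filter]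
    refine (Finset.sum_congr rfl fun g _ => ?_).trans hc
    have key : ∀ a : ZMod 2, a ≠ 0 → a = 1 := by decide
    by_cases hg : c g = 0
    · simp [hg]
    · simp [key _ hg]

lemma isMinDist_dualCode_codeC {m d : ℕ} {D : Finset (Fin m → ZMod 2)} (hd : 0 < d)
    (hex : ∃ S ⊆ D, ∑ x ∈ S, x = 0 ∧ S.card = d)
    (hle : ∀ S ⊆ D, S.Nonempty → ∑ x ∈ S, x = 0 → d ≤ S.card) :
    isMinDist (dualCode (codeC D) : Set (↥D → ZMod 2)) d := by
  constructor
  · obtain ⟨S, hSD, h, rfl⟩ := hex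
    exact exists_mem_dualCode_of_sum_eq_zero hSD (Finset.card_pos.mp hd) h
  · intro c hc hc0
    obtain ⟨S, hSD, hS, h, hcard⟩ := exists_sum_eq_zero_of_mem_dualCode hc hc0
    exact hcard ▸ hle S hSD hS h

lemma three_le_card_of_sum_eq_zero {m : ℕ} {S : Finset (Fin m → ZMod 2)}
    (h0 : 0 ∉ S) (hS : S.Nonempty) (h : ∑ x ∈ S, x = 0) : 3 ≤ S.card := by
  have h1 : S.card ≠ 1 := by
    intro hc
    obtain ⟨x, rfl⟩ := Finset.card_eq_one.mp hc
    simp_all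
  have h2 : S.card ≠ 2 := by
    intro hc
    obtain ⟨x, y, hxy, rfl⟩ := Finset.card_eq_two.mp hc
    rw [Finset.sum_pair hxy] at h
    refine hxy (funext fun i => ?_)
    have key : ∀ a b : ZMod 2, a + b = 0 → a = b := by decide
    exact key _ _ (congrFun h i)
  have := hS.card_pos
  omega

lemma even_card_of_sum_eq_zero {m : ℕ} {S : Finset (Fin m → ZMod 2)} {j : Fin m}
    (hj : ∀ x ∈ S, x j = 1) (h : ∑ x ∈ S, x = 0) : Even S.card := by
  rw [← ZMod.natCast_eq_zero_iff_even]
  have := congrFun h j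
  rw [Finset.sum_apply, Finset.sum_congr rfl hj] at this
  simpa using this

lemma exists_three_sum_eq_zero {m : ℕ} {A B : Fin m → ZMod 2}
    (hBA : supp B ⊂ supp A) (hlt : wt B + 1 < wt A) :
    ∃ S ⊆ delta A \ delta B, ∑ x ∈ S, x = 0 ∧ S.card = 3 := by
  have hcard : 1 < (supp A \ supp B).card := by
    rw [Finset.card_sdiff_of_subset hBA.subset]
    simp only [wt] at hlt
    omega
  obtain ⟨i, hi, j, hj, hij⟩ := Finset.one_lt_card.mp hcard
  simp only [supp, Finset.mem_sdiff, Finset.mem_filter, Finset.mem_univ, true_and,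
    not_not] at hi hj
  have ha := single_mem_delta hi.1
  have hb := single_mem_delta hj.1
  have haD := mem_delta_sdiff_delta ha hi.2 (by simp)
  have hbD := mem_delta_sdiff_delta hb hj.2 (by simp)
  have habD := mem_delta_sdiff_delta (add_mem_delta ha hb) hi.2 (by simp [hij])
  set a : Fin m → ZMod 2 := Pi.single i 1 with ha_def
  set b : Fin m → ZMod 2 := Pi.single j 1 with hb_def
  have h₁ : a ≠ b := fun h => by simpa [ha_def, hb_def, hij] using congrFun h i
  have h₂ : a ≠ a + b := fun h => by simpa [ha_def, hb_def, hij.symm] using congrFun h j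
  have h₃ : b ≠ a + b := fun h => by simpa [ha_def, hb_def, hij] using congrFun h i
  refine ⟨{a, b, a + b}, ?_, ?_, Finset.card_eq_three.mpr ⟨a, b, a + b, h₁, h₂, h₃, rfl⟩⟩
  · simp only [Finset.insert_subset_iff, Finset.singleton_subset_iff]
    exact ⟨haD, hbD, habD⟩
  · rw [Finset.sum_insert (by simp [h₁, h₂]), Finset.sum_pair h₃, ← add_assoc]
    exact ZModModule.add_self _

lemma exists_four_sum_eq_zero {m : ℕ} {A B : Fin m → ZMod 2}
    (hBA : supp B ⊂ supp A) (hlt : 1 < wt B) :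
    ∃ S ⊆ delta A \ delta B, ∑ x ∈ S, x = 0 ∧ S.card = 4 := by
  obtain ⟨j, hjA, hjB⟩ := Finset.exists_of_ssubset hBA
  obtain ⟨k, hk, l, hl, hkl⟩ := Finset.one_lt_card.mp hlt
  have hjk : j ≠ k := fun h => hjB (h ▸ hk)
  have hjl : j ≠ l := fun h => hjB (h ▸ hl)
  have hkA := hBA.subset hk
  have hlA := hBA.subset hl
  simp only [supp, Finset.mem_filter, Finset.mem_univ, true_and, not_not] at hjA hjB hkA hlA
  have ha := single_mem_delta hjA
  have hb := single_mem_delta hkA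
  have hc := single_mem_delta hlA
  have haD := mem_delta_sdiff_delta ha hjB (by simp)
  have habD := mem_delta_sdiff_delta (add_mem_delta ha hb) hjB (by simp [hjk])
  have hacD := mem_delta_sdiff_delta (add_mem_delta ha hc) hjB (by simp [hjl])
  have habcD := mem_delta_sdiff_delta (add_mem_delta (add_mem_delta ha hb) hc) hjB
    (by simp [hjk, hjl])
  set a : Fin m → ZMod 2 := Pi.single j 1
  set b : Fin m → ZMod 2 := Pi.single k 1 with hb_def
  set c : Fin m → ZMod 2 := Pi.single l 1 with hc_def
  have h₁ : a ≠ a + b := fun h => by simpa [hb_def] using congrFun h k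
  have h₂ : a ≠ a + c := fun h => by simpa [hc_def] using congrFun h l
  have h₃ : a ≠ a + b + c := fun h => by
    simpa [hb_def, hc_def, hkl, add_assoc] using congrFun h k
  have h₄ : a + b ≠ a + c := fun h => by simpa [hb_def, hc_def, hkl] using congrFun h k
  have h₅ : a + b ≠ a + b + c := fun h => by simpa [hc_def] using congrFun h l
  have h₆ : a + c ≠ a + b + c := fun h => by
    simpa [hb_def, hc_def, hkl, add_assoc] using congrFun h k
  refine ⟨{a, a + b, a + c, a + b + c}, ?_, ?_, ?_⟩
  · simp only [Finset.insert_subset_iff, Finset.singleton_subset_iff]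
    exact ⟨haD, habD, hacD, habcD⟩
  · rw [Finset.sum_insert (by simp only [Finset.mem_insert, Finset.mem_singleton]; tauto),
      Finset.sum_insert (by simp only [Finset.mem_insert, Finset.mem_singleton]; tauto),
      Finset.sum_pair h₆]
    calc a + (a + b + (a + c + (a + b + c))) = (a + a) + (a + a) + (b + b) + (c + c) := by abel
      _ = 0 := by simp only [ZModModule.add_self]
  · rw [Finset.card_insert_of_notMem, Finset.card_insert_of_notMem, Finset.card_pair h₆] <;>
      simp only [Finset.mem_insert, Finset.mem_singleton] <;> tauto

theorem stmt3 {m : ℕ} (hm : 3 ≤ m) (A B : Fin m → ZMod 2)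
    (hBA : supp B ⊂ supp A)
    (D : Finset (Fin m → ZMod 2)) (hD : D = delta A \ delta B) :
    D.card = 2 ^ wt A - 2 ^ wt B ∧
    Module.finrank (ZMod 2) (dualCode (codeC D)) = 2 ^ wt A - 2 ^ wt B - wt A ∧
    (wt B + 1 < wt A → isMinDist (dualCode (codeC D) : Set (↥D → ZMod 2)) 3) ∧
    (wt A = wt B + 1 → 3 ≤ wt A →
      isMinDist (dualCode (codeC D) : Set (↥D → ZMod 2)) 4) := by
  subst hD
  have hsub : delta B ⊆ delta A := fun v hv =>
    Finset.mem_filter.mpr ⟨Finset.mem_univ _, (Finset.mem_filter.mp hv).2.trans hBA.subset⟩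
  have hcard : (delta A \ delta B).card = 2 ^ wt A - 2 ^ wt B := by
    rw [Finset.card_sdiff_of_subset hsub, card_delta, card_delta]
  have hthree : ∀ S ⊆ delta A \ delta B, S.Nonempty → ∑ x ∈ S, x = 0 → 3 ≤ S.card := by
    refine fun S hSD => three_le_card_of_sum_eq_zero fun h0 => ?_
    exact (Finset.mem_sdiff.mp (hSD h0)).2 (by simp [mem_delta])
  refine ⟨hcard, ?_, fun hlt => ?_, fun heq h3 => ?_⟩
  · rw [finrank_dualCode_codeC, finrank_span_delta_sdiff_delta hBA, hcard]
  · exact isMinDist_dualCode_codeC (by norm_num) (exists_three_sum_eq_zero hBA hlt) hthree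
  · refine isMinDist_dualCode_codeC (by norm_num)
      (exists_four_sum_eq_zero hBA (by omega)) fun S hSD hS h => ?_
    obtain ⟨j, hj⟩ : ∃ j, supp A \ supp B = {j} := by
      rw [← Finset.card_eq_one, Finset.card_sdiff_of_subset hBA.subset]
      simp only [wt] at heq
      omega
    have hone : ∀ x ∈ S, x j = 1 := by
      intro x hx
      have hxD := hSD hx
      simp only [delta, Finset.mem_sdiff, Finset.mem_filter, Finset.mem_univ, true_and,
        Finset.not_subset] at hxD
      obtain ⟨hxA, i, hix, hiB⟩ := hxD
      obtain rfl := Finset.mem_singleton.mp (hj ▸ Finset.mem_sdiff.mpr ⟨hxA hix, hiB⟩)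
      have key : ∀ a : ZMod 2, a ≠ 0 → a = 1 := by decide
      exact key _ (Finset.mem_filter.mp hix).2
    obtain ⟨r, hr⟩ := even_card_of_sum_eq_zero hone h
    have := hthree S hSD hS h
    omega
end

section
/- Let m be a positive even integer, let k = m/2, and let {A_1, ..., A_k} be a partition of {1, ..., m} into k sets each of size 2. Let D = (Δ_{A_1} ∪ ... ∪ Δ_{A_k}) \ {0}, where Δ_{A_i} = {v ∈ F_2^m : supp(v) ⊆ A_i}. Then the binary linear code C_D has length 3m/2, dimension m over F_2, and minimum distance 2; moreover, for each integer 0 ≤ l ≤ k, the number of codewords of C_D of Hamming weight m − 2l equals C(k, l) · 3^{k−l}, and every codeword has weight of the form m − 2l for some 0 ≤ l ≤ k. -/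
open Finset

/-- The number of functions with exactly `n` nonzero values. -/
theorem card_filter_card_support_eq {ι α : Type*} [Fintype ι] [DecidableEq ι] [Fintype α]
    [DecidableEq α] [Zero α] (n : ℕ) :
    #{w : ι → α | #{i | w i ≠ 0} = n} =
      (Fintype.card ι).choose n * (Fintype.card α - 1) ^ n := by
  have hmaps : ∀ w ∈ ({w : ι → α | #{i | w i ≠ 0} = n} : Finset (ι → α)),
      ({i | w i ≠ 0} : Finset ι) ∈ powersetCard n (univ : Finset ι) := by
    intro w hw
    simpa [mem_powersetCard] using hw
  rw [card_eq_sum_card_fiberwise hmaps]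
  have hfiber : ∀ S ∈ powersetCard n (univ : Finset ι),
      #{w ∈ ({w : ι → α | #{i | w i ≠ 0} = n} : Finset (ι → α)) |
        ({i | w i ≠ 0} : Finset ι) = S} = (Fintype.card α - 1) ^ n := by
    intro S hS
    obtain ⟨-, rfl⟩ := mem_powersetCard.1 hS
    have hpi : ({w ∈ ({w : ι → α | #{i | w i ≠ 0} = #S} : Finset (ι → α)) |
        ({i | w i ≠ 0} : Finset ι) = S}) =
        Fintype.piFinset fun i => if i ∈ S then univ.erase (0 : α) else {0} := by
      ext w
      simp only [mem_filter, mem_univ, true_and, Fintype.mem_piFinset]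
      constructor
      · rintro ⟨-, rfl⟩ i
        by_cases h : w i = 0 <;> simp [h]
      · intro h
        have hw : ({i | w i ≠ 0} : Finset ι) = S := by
          ext i
          have := h i
          by_cases hi : i ∈ S <;> simp_all
        exact ⟨by rw [hw], hw⟩
    rw [hpi, Fintype.card_piFinset]
    simp only [apply_ite Finset.card, card_erase_of_mem (mem_univ _), card_univ, card_singleton]
    simp
  rw [sum_congr rfl hfiber]
  simp [card_powersetCard]

theorem exists_equiv_of_partition {m k n : ℕ} (A : Fin k → Finset (Fin m))
    (hcard : ∀ i, #(A i) = n) (hdisj : ∀ i j, i ≠ j → Disjoint (A i) (A j))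
    (hcover : ∀ x, ∃ i, x ∈ A i) :
    ∃ e : Fin k × Fin n ≃ Fin m, ∀ i x, x ∈ A i ↔ (e.symm x).1 = i := by
  have huniq : ∀ {i j x}, x ∈ A i → x ∈ A j → i = j := fun {i j x} hi hj => by
    by_contra h
    exact disjoint_left.1 (hdisj i j h) hi hj
  let f : Fin k × Fin n → Fin m := fun p => ((A p.1).equivFinOfCardEq (hcard p.1)).symm p.2
  have hf : ∀ p, f p ∈ A p.1 := fun p => Subtype.prop _
  have hbij : Function.Bijective f := by
    constructor
    · rintro ⟨i, a⟩ ⟨j, b⟩ h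
      obtain rfl : i = j := huniq (hf (i, a)) (by rw [h]; exact hf (j, b))
      have := ((A i).equivFinOfCardEq (hcard i)).symm.injective (Subtype.ext h)
      exact Prod.ext rfl this
    · intro x
      obtain ⟨i, hi⟩ := hcover x
      exact ⟨(i, (A i).equivFinOfCardEq (hcard i) ⟨x, hi⟩), by simp [f]⟩
  refine ⟨Equiv.ofBijective f hbij, fun i x => ?_⟩
  obtain ⟨p, rfl⟩ := (Equiv.ofBijective f hbij).surjective x
  rw [Equiv.symm_apply_apply]
  exact ⟨fun h => huniq (hf p) h, fun h => h ▸ hf p⟩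

/-- The vector equal to `v` on the `i`-th block and zero elsewhere. -/
def blockVector {m k n : ℕ} (e : Fin k × Fin n ≃ Fin m) (i : Fin k) (v : Fin n → ZMod 2) :
    Fin m → ZMod 2 :=
  fun x => if (e.symm x).1 = i then v (e.symm x).2 else 0

theorem blockVector_apply {m k n : ℕ} (e : Fin k × Fin n ≃ Fin m) (i j : Fin k) (a : Fin n)
    (v : Fin n → ZMod 2) : blockVector e i v (e (j, a)) = if j = i then v a else 0 := by
  simp [blockVector]

theorem sum_mul_blockVector {m k n : ℕ} (e : Fin k × Fin n ≃ Fin m) (i : Fin k)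
    (v : Fin n → ZMod 2) (u : Fin m → ZMod 2) :
    ∑ x, u x * blockVector e i v x = ∑ a, u (e (i, a)) * v a := by
  rw [← e.sum_comp, Fintype.sum_prod_type]
  simp only [blockVector_apply]
  rw [sum_eq_single i] <;> simp +contextual

theorem exists_equiv_blockVector {m k n : ℕ} (A : Fin k → Finset (Fin m))
    (e : Fin k × Fin n ≃ Fin m) (he : ∀ i x, x ∈ A i ↔ (e.symm x).1 = i)
    (D : Finset (Fin m → ZMod 2)) (hD : D = (univ.biUnion fun i => deltaT (A i)) \ {0}) :
    ∃ E : Fin k × {v : Fin n → ZMod 2 // v ≠ 0} ≃ D,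
      ∀ p, (E p : Fin m → ZMod 2) = blockVector e p.1 p.2 := by
  have hmem : ∀ g, g ∈ D ↔ (∃ i, ∀ x, g x ≠ 0 → (e.symm x).1 = i) ∧ g ≠ 0 := by
    intro g
    simp [hD, deltaT, supp, subset_iff, he]
  have hne : ∀ p : Fin k × {v : Fin n → ZMod 2 // v ≠ 0}, ∃ a, (p.2 : Fin n → ZMod 2) a ≠ 0 :=
    fun p => Function.ne_iff.1 p.2.2
  let f : Fin k × {v : Fin n → ZMod 2 // v ≠ 0} → D := fun p =>
    ⟨blockVector e p.1 p.2, (hmem _).2 ⟨⟨p.1, fun x hx => by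
      by_contra h
      exact hx (by simp [blockVector, h])⟩, by
      obtain ⟨a, ha⟩ := hne p
      exact Function.ne_iff.2 ⟨e (p.1, a), by simpa [blockVector_apply] using ha⟩⟩⟩
  refine ⟨Equiv.ofBijective f ⟨?_, ?_⟩, fun p => rfl⟩
  · rintro ⟨i, v⟩ ⟨j, w⟩ h
    have h' : blockVector e i v = blockVector e j w := congrArg Subtype.val h
    obtain ⟨a, ha⟩ := hne (i, v)
    have hij : i = j := by
      by_contra hij
      have := congrFun h' (e (i, a))
      simp only [blockVector_apply, if_true, if_neg hij] at this
      exact ha this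
    subst hij
    congr 1
    ext a
    have := congrFun h' (e (i, a))
    simp only [blockVector_apply, if_true] at this
    rw [this]
  · rintro ⟨g, hg⟩
    obtain ⟨⟨i, hi⟩, hg0⟩ := (hmem g).1 hg
    have hblock : blockVector e i (fun a => g (e (i, a))) = g := by
      ext x
      obtain ⟨⟨j, a⟩, rfl⟩ := e.surjective x
      rw [blockVector_apply]
      split_ifs with h
      · rw [h]
      · by_contra h0
        exact h (by simpa using hi _ (Ne.symm h0))
    refine ⟨(i, ⟨fun a => g (e (i, a)), fun h0 => hg0 ?_⟩), Subtype.ext hblock⟩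
    rw [← hblock, h0]
    ext x
    simp [blockVector]

theorem card_dot_ne_zero (w : Fin 2 → ZMod 2) :
    #{v : {v : Fin 2 → ZMod 2 // v ≠ 0} | ∑ a, w a * (v : Fin 2 → ZMod 2) a ≠ 0} =
      if w ≠ 0 then 2 else 0 := by
  revert w
  decide

theorem stmt7 {m k : ℕ} (hm : 0 < m) (hk : m = 2 * k)
    (A : Fin k → Finset (Fin m))
    (hcard : ∀ i, (A i).card = 2)
    (hdisj : ∀ i j, i ≠ j → Disjoint (A i) (A j))
    (hcover : ∀ x : Fin m, ∃ i, x ∈ A i)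
    (D : Finset (Fin m → ZMod 2))
    (hD : D = (Finset.univ.biUnion fun i => deltaT (A i)) \ {0}) :
    D.card = 3 * m / 2 ∧
    Module.finrank (ZMod 2) (codeC D) = m ∧
    isMinDist (codeC D : Set (↥D → ZMod 2)) 2 ∧
    (∀ l ≤ k, {c : ↥D → ZMod 2 | c ∈ codeC D ∧ hwt c = m - 2 * l}.ncard
        = Nat.choose k l * 3 ^ (k - l)) ∧
    ∀ c ∈ codeC D, ∃ l ≤ k, hwt c = m - 2 * l := by
  obtain ⟨e, he⟩ := exists_equiv_of_partition A hcard hdisj hcover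
  obtain ⟨E, hE⟩ := exists_equiv_blockVector A e he D hD
  let L := Matrix.mulVecLin (Matrix.of fun (g : ↥D) (i : Fin m) => (g : Fin m → ZMod 2) i)
  let B : (Fin m → ZMod 2) ≃ (Fin k → Fin 2 → ZMod 2) :=
    (e.arrowCongr (Equiv.refl _)).symm.trans (Equiv.curry _ _ _)
  have hB : ∀ u i a, B u i a = u (e (i, a)) := fun u i a => rfl
  have hB0 : B 0 = 0 := rfl
  have hweight : ∀ u, hwt (L u) = 2 * #{i | B u i ≠ 0} := by
    intro u
    have hL : ∀ p, L u (E p) = ∑ a, B u p.1 a * (p.2 : Fin 2 → ZMod 2) a := by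
      intro p
      simp only [hB]
      rw [← sum_mul_blockVector, ← hE]
      simp [L, Matrix.mulVec, dotProduct, mul_comm]
    have hcount : hwt (L u) = ∑ g, if L u g ≠ 0 then 1 else 0 := by
      simp [hwt, card_filter]
    rw [hcount, ← E.sum_comp, Fintype.sum_prod_type]
    simp only [hL, ← card_filter, card_dot_ne_zero]
    rw [← sum_filter, sum_const, smul_eq_mul, mul_comm]
  have hsupp : ∀ u, #{i | B u i ≠ 0} = 0 → u = 0 := by
    intro u hu
    apply B.injective
    rw [hB0]
    ext1 i
    by_contra hi
    exact filter_eq_empty_iff.1 (card_eq_zero.1 hu) (mem_univ i) hi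
  have hinj : Function.Injective L := by
    rw [← LinearMap.ker_eq_bot, LinearMap.ker_eq_bot']
    intro u hu
    apply hsupp
    have := hweight u
    rw [hu] at this
    simp [hwt] at this
    simpa using this
  have hle : ∀ u, #{i | B u i ≠ 0} ≤ k := fun u => by
    simpa using card_filter_le univ fun i => B u i ≠ 0
  refine ⟨?_, ?_, ⟨?_, ?_⟩, ?_, ?_⟩
  · have h3 : Fintype.card {v : Fin 2 → ZMod 2 // v ≠ 0} = 3 := by decide
    have := Fintype.card_congr E
    rw [Fintype.card_prod, h3, Fintype.card_fin, Fintype.card_coe] at this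
    omega
  · exact (LinearMap.finrank_range_of_inj hinj).trans (by simp)
  · let i₀ : Fin k := ⟨0, by omega⟩
    let w : Fin k → Fin 2 → ZMod 2 := Pi.single i₀ 1
    have hw : hwt (L (B.symm w)) = 2 := by
      rw [hweight, Equiv.apply_symm_apply]
      have : ({i | w i ≠ 0} : Finset (Fin k)) = {i₀} := by
        ext i
        by_cases h : i = i₀ <;> simp [w, h]
      rw [this, card_singleton]
    refine ⟨_, ⟨_, rfl⟩, fun h0 => ?_, hw⟩
    change L (B.symm w) = 0 at h0
    simp [h0, hwt] at hw
  · rintro _ ⟨u, rfl⟩ hu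
    change 2 ≤ hwt (L u)
    rw [hweight]
    have : #{i | B u i ≠ 0} ≠ 0 := fun h => hu (by rw [hsupp u h, map_zero])
    omega
  · intro l hl
    have hset : {c : ↥D → ZMod 2 | c ∈ codeC D ∧ hwt c = m - 2 * l} =
        (L ∘ B.symm) '' ↑({w | #{i | w i ≠ 0} = k - l} :
          Finset (Fin k → Fin 2 → ZMod 2)) := by
      ext c
      simp only [Set.mem_ofPred_eq, Set.mem_image, coe_filter, mem_univ, true_and]
      constructor
      · rintro ⟨⟨u, rfl⟩, hu⟩
        change hwt (L u) = _ at hu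
        rw [hweight] at hu
        exact ⟨B u, by omega, by simp [L]⟩
      · rintro ⟨w, hw, rfl⟩
        refine ⟨⟨_, rfl⟩, ?_⟩
        rw [Function.comp_apply, hweight, Equiv.apply_symm_apply, hw]
        omega
    rw [hset, Set.ncard_image_of_injective _ (hinj.comp B.symm.injective), Set.ncard_coe_finset,
      card_filter_card_support_eq, Fintype.card_fin, Nat.choose_symm hl]
    simp
  · rintro _ ⟨u, rfl⟩
    refine ⟨k - #{i | B u i ≠ 0}, Nat.sub_le _ _, ?_⟩
    change hwt (L u) = _
    rw [hweight]
    have := hle u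
    omega
end

section
/- Let m be a positive even integer, let k = m/2, and let {A_1, ..., A_k} be a partition of {1, ..., m} into k sets each of size 2. Let D = (Δ_{A_1} ∪ ... ∪ Δ_{A_k}) \ {0}, where Δ_{A_i} = {v ∈ F_2^m : supp(v) ⊆ A_i}. Then the binary linear code C_D is an LCD code, i.e., C_D ∩ C_D^⊥ = {0}. -/
open Finset

/-- A vector supported in `{x, y}` with nonzero `y`-coordinate is `e_y` or `e_x + e_y`. -/
lemma eq_single_or_eq_add_single {m : ℕ} {x y : Fin m} (hxy : x ≠ y) {g : Fin m → ZMod 2}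
    (hg : supp g ⊆ {x, y}) (hy : g y ≠ 0) :
    g = Pi.single y 1 ∨ g = Pi.single x 1 + Pi.single y 1 := by
  have one_of_ne : ∀ a : ZMod 2, a ≠ 0 → a = 1 := by decide
  have hzero : ∀ z, z ≠ x → z ≠ y → g z = 0 := by
    intro z hzx hzy
    by_contra h
    have hz : z ∈ supp g := by simp [supp, h]
    simpa [hzx, hzy] using hg hz
  have hgy := one_of_ne _ hy
  by_cases hx : g x = 0
  · left
    ext1 z
    by_cases hzy : z = y
    · simp [hzy, hgy]
    · by_cases hzx : z = x
      · simp [hzx, hx, hxy]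
      · simp [hzy, hzero z hzx hzy]
  · right
    have hgx := one_of_ne _ hx
    ext1 z
    by_cases hzy : z = y
    · simp [hzy, hgy, hxy.symm]
    · by_cases hzx : z = x
      · simp [hzx, hgx, hxy]
      · simp [hzy, hzx, hzero z hzx hzy]

/-- If `e_y` and `e_x + e_y` are the only members of `D` with nonzero `y`-coordinate, then the
codewords of `u` and `e_y` pair to `u x`. -/
lemma sum_dotProduct_mul_apply {m : ℕ} {x y : Fin m} (hxy : x ≠ y)
    {D : Finset (Fin m → ZMod 2)} (hy : Pi.single y 1 ∈ D)
    (hx : Pi.single x 1 + Pi.single y 1 ∈ D)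
    (hD : ∀ g ∈ D, g y ≠ 0 → g = Pi.single y 1 ∨ g = Pi.single x 1 + Pi.single y 1)
    (u : Fin m → ZMod 2) :
    ∑ g ∈ D, (g ⬝ᵥ u) * g y = u x := by
  have hne : (Pi.single y 1 : Fin m → ZMod 2) ≠ Pi.single x 1 + Pi.single y 1 := by
    intro h
    simpa [hxy] using congrFun h x
  rw [← Finset.sum_subset (s₁ := {Pi.single y 1, Pi.single x 1 + Pi.single y 1}),
    Finset.sum_pair hne]
  · simp [add_dotProduct, hxy.symm, add_left_comm (u y), CharTwo.add_self_eq_zero]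
  · intro g hg
    simp only [Finset.mem_insert, Finset.mem_singleton] at hg
    rcases hg with rfl | rfl <;> assumption
  · intro g hg hg'
    by_contra h
    exact hg' (by simpa using hD g hg (right_ne_zero_of_mul h))

theorem stmt12 {m k : ℕ} (hm : 0 < m) (hk : m = 2 * k)
    (A : Fin k → Finset (Fin m))
    (hcard : ∀ i, (A i).card = 2)
    (hdisj : ∀ i j, i ≠ j → Disjoint (A i) (A j))
    (hcover : ∀ x : Fin m, ∃ i, x ∈ A i)
    (D : Finset (Fin m → ZMod 2))
    (hD : D = (Finset.univ.biUnion fun i => deltaT (A i)) \ {0}) :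
    codeC D ⊓ dualCode (codeC D) = ⊥ := by
  rw [eq_bot_iff]
  rintro _ ⟨⟨u, rfl⟩, hdual⟩
  suffices hu : u = 0 by simp [hu]
  ext1 x
  obtain ⟨i, hxi⟩ := hcover x
  obtain ⟨y, hyi, hyx⟩ := Finset.exists_mem_ne (s := A i) (by simp [hcard i]) x
  have hAi : A i = {x, y} := by
    refine (Finset.eq_of_subset_of_card_le ?_ ?_).symm
    · simp [Finset.insert_subset_iff, hxi, hyi]
    · rw [hcard, Finset.card_pair hyx.symm]
  have hmem : ∀ g : Fin m → ZMod 2, g ∈ D ↔ (∃ j, supp g ⊆ A j) ∧ g ≠ 0 := by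
    simp [hD, deltaT]
  have hsum := sum_dotProduct_mul_apply (D := D) hyx.symm ?_ ?_ ?_ u
  · rw [← hsum, Pi.zero_apply, ← Finset.sum_coe_sort]
    simpa [Matrix.mulVec] using hdual _ ⟨Pi.single y 1, rfl⟩
  · refine (hmem _).2 ⟨⟨i, fun z hz => ?_⟩, by simp⟩
    have hzy : z = y := by simpa [supp, Pi.single_apply] using hz
    exact hzy ▸ hyi
  · refine (hmem _).2 ⟨⟨i, fun z hz => ?_⟩, fun h => ?_⟩
    · rw [hAi]
      by_contra hz'
      simp only [Finset.mem_insert, Finset.mem_singleton, not_or] at hz'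
      simp [supp, hz'.1, hz'.2] at hz
    · simpa [hyx.symm] using congrFun h x
  · intro g hg hgy
    obtain ⟨⟨j, hj⟩, -⟩ := (hmem g).1 hg
    have hyj : y ∈ A j := hj (by simp [supp, hgy])
    have hij : i = j := by
      by_contra h
      exact Finset.disjoint_left.1 (hdisj i j h) hyi hyj
    subst hij
    exact eq_single_or_eq_add_single hyx.symm (hAi ▸ hj) hgy
end

section
/- Let Δ ⊆ F_2^m be a nonempty simplicial complex and let F be the set of maximal elements of Δ. Then in the polynomial ring ℤ[x_1, ..., x_m] one has the identity ∑_{u ∈ Δ} ∏_{i ∈ supp(u)} x_i = ∑_{∅ ≠ S ⊆ F} (−1)^{|S|+1} ∏_{i ∈ ∩_{v ∈ S} supp(v)} (1 + x_i). -/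
open Finset

theorem supp_injective {m : ℕ} : Function.Injective (supp : (Fin m → ZMod 2) → Finset (Fin m)) := by
  intro u v h
  funext i
  have hi : u i ≠ 0 ↔ v i ≠ 0 := by simpa [supp] using Finset.ext_iff.mp h i
  revert hi
  generalize u i = a
  generalize v i = b
  revert a b
  decide

theorem supp_surjective {m : ℕ} :
    Function.Surjective (supp : (Fin m → ZMod 2) → Finset (Fin m)) := by
  intro T
  refine ⟨fun i => if i ∈ T then 1 else 0, ?_⟩
  ext i
  simp [supp]

theorem exists_maximal_supp_superset {m : ℕ} (Δ : Finset (Fin m → ZMod 2))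
    {u : Fin m → ZMod 2} (hu : u ∈ Δ) :
    ∃ w ∈ Δ.filter fun u => ∀ w ∈ Δ, ¬ supp u ⊂ supp w, supp u ⊆ supp w := by
  obtain ⟨w, hw, hmax⟩ := (Δ.filter fun w => supp u ⊆ supp w).exists_max_image
    (fun w => (supp w).card) ⟨u, by simp [hu]⟩
  rw [Finset.mem_filter] at hw
  refine ⟨w, Finset.mem_filter.mpr ⟨hw.1, fun z hz hwz => ?_⟩, hw.2⟩
  exact (Finset.card_lt_card hwz).not_ge
    (hmax z (Finset.mem_filter.mpr ⟨hz, hw.2.trans hwz.subset⟩))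

theorem image_supp_eq_biUnion_powerset {m : ℕ} (Δ : Finset (Fin m → ZMod 2))
    (hsc : ∀ u v : Fin m → ZMod 2, u ∈ Δ → supp v ⊆ supp u → v ∈ Δ) :
    Δ.image supp =
      (Δ.filter fun u => ∀ w ∈ Δ, ¬ supp u ⊂ supp w).biUnion fun u => (supp u).powerset := by
  ext T
  simp only [Finset.mem_image, Finset.mem_biUnion, Finset.mem_powerset]
  constructor
  · rintro ⟨u, hu, rfl⟩
    exact exists_maximal_supp_superset Δ hu
  · rintro ⟨w, hw, hT⟩
    obtain ⟨v, rfl⟩ := supp_surjective T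
    exact ⟨v, hsc w v (Finset.mem_filter.mp hw).1 hT, rfl⟩

theorem inf'_powerset_eq_powerset_inf {ι α : Type*} [Fintype α] [DecidableEq α] (S : Finset ι)
    (hS : S.Nonempty) (f : ι → Finset α) :
    (S.inf' hS fun i => (f i).powerset) = (S.inf f).powerset := by
  ext T
  rw [Finset.inf'_eq_inf, Finset.mem_inf]
  simp only [Finset.mem_powerset]
  exact Finset.le_inf_iff.symm

theorem stmt18 {m : ℕ} (Δ : Finset (Fin m → ZMod 2)) (hne : Δ.Nonempty)
    (hsc : ∀ u v : Fin m → ZMod 2, u ∈ Δ → supp v ⊆ supp u → v ∈ Δ)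
    (F : Finset (Fin m → ZMod 2))
    (hF : F = Δ.filter fun u => ∀ w ∈ Δ, ¬ supp u ⊂ supp w) :
    ∑ u ∈ Δ, ∏ i ∈ supp u, (MvPolynomial.X i : MvPolynomial (Fin m) ℤ) =
      ∑ S ∈ F.powerset.filter (· ≠ ∅),
        (-1 : MvPolynomial (Fin m) ℤ) ^ (S.card + 1) *
          ∏ i ∈ S.inf supp, (1 + MvPolynomial.X i) := by
  have hsum : ∑ u ∈ Δ, ∏ i ∈ supp u, (MvPolynomial.X i : MvPolynomial (Fin m) ℤ) =
      ∑ T ∈ Δ.image supp, ∏ i ∈ T, MvPolynomial.X i := by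
    rw [Finset.sum_image supp_injective.injOn]
  rw [hsum, image_supp_eq_biUnion_powerset Δ hsc, ← hF, Finset.inclusion_exclusion_sum_biUnion]
  simp only [← Finset.nonempty_iff_ne_empty]
  rw [← Finset.sum_coe_sort (F.powerset.filter (·.Nonempty))]
  refine Finset.sum_congr rfl fun S _ => ?_
  rw [inf'_powerset_eq_powerset_inf, Finset.prod_one_add, zsmul_eq_mul]
  push_cast
  rfl
end
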